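/- Let β, β̃ ∈ (0,1) with β + 2β̃ > 1, and T > 0. Let v ∈ C^β([0,T] × 𝕋³; ℝ³) be a divergence-free vector field and let ρ ∈ C^{β̃}([0,T] × 𝕋³; ℝ) be a weak solution of the transport equation ∂_t ρ + div(vρ) = 0. Then ρ conserves its L²-energy: for every t ∈ [0,T], ∫_{𝕋³} |ρ(t,x)|² dx = ∫_{𝕋³} |ρ(0,x)|² dx. -/

import Mathlib

open MeasureTheory
open scoped BigOperators NNReal ENNReal

noncomputable section

/-- Points of `ℝ³`; periodic functions on it represent functions on the torus `𝕋³`. -/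
abbrev V3 := Fin 3 → ℝ

/-- Partial derivative `∂ᵢ f` of a scalar function on `ℝ³`. -/
noncomputable def pd (i : Fin 3) (f : V3 → ℝ) (x : V3) : ℝ :=
  fderiv ℝ f x (Pi.single i 1)

/-- Gradient of a scalar function on `ℝ³`. -/
noncomputable def grad3 (f : V3 → ℝ) (x : V3) : V3 := fun i => pd i f x

/-- Euclidean inner product on `ℝ³`. -/
def dot3 (a b : V3) : ℝ := ∑ i, a i * b i

/-- `ℤ³`-periodicity of a scalar function on `ℝ³` (i.e. it descends to `𝕋³ = ℝ³/ℤ³`). -/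
def ZPer (f : V3 → ℝ) : Prop :=
  ∀ (x : V3) (n : Fin 3 → ℤ), f (x + fun i => (n i : ℝ)) = f x

/-- `ℤ³`-periodicity (in space) of a space-time scalar function. -/
def ZPerST (f : ℝ × V3 → ℝ) : Prop :=
  ∀ (t : ℝ) (x : V3) (n : Fin 3 → ℤ), f (t, x + fun i => (n i : ℝ)) = f (t, x)

/-- `ℤ³`-periodicity (in space) of a space-time vector field. -/
def ZPerSTv (v : ℝ × V3 → V3) : Prop :=
  ∀ (t : ℝ) (x : V3) (n : Fin 3 → ℤ), v (t, x + fun i => (n i : ℝ)) = v (t, x)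

/-- `v(t, ·)` is divergence-free in the distributional sense on `𝕋³`, for every `t`:
tested against smooth periodic test functions over the fundamental domain `[0,1]³`. -/
def WeaklyDivFree (v : ℝ × V3 → V3) : Prop :=
  ∀ (t : ℝ) (φ : V3 → ℝ), ContDiff ℝ (⊤ : ℕ∞) φ → ZPer φ →
    ∫ x in Set.Icc (0 : V3) 1, dot3 (v (t, x)) (grad3 φ x) = 0

/-- `ρ` is a weak (distributional) solution on `[0,T] × 𝕋³` of the transport equation
`∂_t ρ + div (v ρ) = 0` : for every smooth spatially periodic test function `φ` and every
`t ∈ [0,T]`,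
`∫₀ᵗ ∫ (ρ ∂_s φ + ρ v·∇φ) dx ds = ∫ ρ(t) φ(t) dx − ∫ ρ(0) φ(0) dx`. -/
def IsWeakTransportSol (T : ℝ) (v : ℝ × V3 → V3) (ρ : ℝ × V3 → ℝ) : Prop :=
  ∀ φ : ℝ × V3 → ℝ, ContDiff ℝ (⊤ : ℕ∞) φ → ZPerST φ →
    ∀ t ∈ Set.Icc (0 : ℝ) T,
      (∫ s in (0:ℝ)..t, ∫ x in Set.Icc (0 : V3) 1,
          (ρ (s, x) * deriv (fun r => φ (r, x)) s
            + ρ (s, x) * dot3 (v (s, x)) (grad3 (fun y => φ (s, y)) x)))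
        = (∫ x in Set.Icc (0 : V3) 1, ρ (t, x) * φ (t, x))
          - ∫ x in Set.Icc (0 : V3) 1, ρ (0, x) * φ (0, x)

local notation "𝒬" => Set.Icc (0 : V3) 1

lemma ZPer.setIntegral_comp_add {f : V3 → ℝ} (hf : ZPer f) (y : V3) :
    ∫ x in 𝒬, f (x + y) = ∫ x in 𝒬, f x := by
  have hae : (ZSpan.fundamentalDomain (Pi.basisFun ℝ (Fin 3)) : Set V3) =ᵐ[volume] 𝒬 := by
    rw [ZSpan.fundamentalDomain_pi_basisFun]
    exact Measure.univ_pi_Ico_ae_eq_Icc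
  have hD := ZSpan.isAddFundamentalDomain (Pi.basisFun ℝ (Fin 3)) (volume : Measure V3)
  have hD' := hD.vadd_of_comm y
  have hinv : ∀ (g : Submodule.span ℤ (Set.range (Pi.basisFun ℝ (Fin 3)))) (x : V3),
      f (g +ᵥ x) = f x := by
    rintro ⟨g, hg⟩ x
    obtain ⟨c, hc⟩ := (Submodule.mem_span_range_iff_exists_fun ℤ).1 hg
    have hg' : g = fun i => ((c i : ℤ) : ℝ) := by
      rw [← hc]
      ext i
      simp [Finset.sum_apply, Pi.single_apply]
    change f (g + x) = f x
    rw [hg', add_comm]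
    exact hf x c
  have : VAddInvariantMeasure (Submodule.span ℤ (Set.range (Pi.basisFun ℝ (Fin 3)))) V3 volume :=
    inferInstanceAs <| VAddInvariantMeasure
      (Submodule.span ℤ (Set.range (Pi.basisFun ℝ (Fin 3)))).toAddSubgroup V3 volume
  rw [← setIntegral_congr_set hae, ← setIntegral_congr_set hae, hD.setIntegral_eq hD' hinv,
    ← Set.image_vadd, (measurePreserving_vadd y volume).setIntegral_image_emb
      (measurableEmbedding_const_vadd y)]
  simp only [vadd_eq_add, add_comm]

lemma setIntegral_cube_reflect (f : V3 → ℝ) : ∫ x in 𝒬, f (1 - x) = ∫ x in 𝒬, f x := by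
  rw [← integral_indicator measurableSet_Icc, ← integral_indicator measurableSet_Icc,
    ← integral_sub_left_eq_self _ volume (1 : V3)]
  congr 1
  ext x
  have : (1 - x ∈ 𝒬) ↔ x ∈ 𝒬 := by
    simp only [Set.mem_Icc]
    constructor <;> rintro ⟨h1, h2⟩ <;> constructor <;> simp_all
  by_cases hx : x ∈ 𝒬
  · rw [Set.indicator_of_mem hx, Set.indicator_of_mem (this.2 hx)]
    simp
  · rw [Set.indicator_of_notMem hx, Set.indicator_of_notMem (mt this.1 hx)]

lemma pd_comp_sub (i : Fin 3) (f : V3 → ℝ) (y x : V3) :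
    pd i (fun z => f (z - y)) x = pd i f (x - y) := by
  rw [pd, pd, fderiv_comp_sub]

lemma pd_neg_of_even (i : Fin 3) {f : V3 → ℝ} (hf : ∀ x, f (-x) = f x) (x : V3) :
    pd i f (-x) = - pd i f x := by
  have h : f = fun z => f (-z) := funext fun z => (hf z).symm
  have : fderiv ℝ f x = - fderiv ℝ f (-x) := by
    conv_lhs => rw [h]
    simpa using fderiv_comp_smul (c := (-1 : ℝ)) (f := f) (x := x)
  rw [pd, pd, this]; simp

lemma continuous_pd (i : Fin 3) {f : V3 → ℝ} (hf : ContDiff ℝ (⊤ : ℕ∞) f) :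
    Continuous (pd i f) :=
  (hf.continuous_fderiv (by simp)).clm_apply continuous_const

lemma ZPer.pd {f : V3 → ℝ} (hf : ZPer f) (i : Fin 3) : ZPer (pd i f) := by
  intro x n
  have h : f = fun z => f (z + fun i => (n i : ℝ)) := funext fun z => (hf z n).symm
  rw [_root_.pd, _root_.pd]
  conv_rhs => rw [h, fderiv_comp_add_right]

lemma ZPer.comp_sub {f : V3 → ℝ} (hf : ZPer f) (y : V3) : ZPer (fun z => f (z - y)) := by
  intro x n
  simp only
  rw [← hf (x - y) n]
  congr 1; abel

lemma ZPer.setIntegral_comp_sub {f : V3 → ℝ} (hf : ZPer f) (y : V3) :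
    ∫ x in 𝒬, f (x - y) = ∫ x in 𝒬, f x := by
  simpa only [sub_eq_add_neg] using hf.setIntegral_comp_add (-y)

lemma ZPer.setIntegral_comp_sub_left {f : V3 → ℝ} (hf : ZPer f) (x : V3) :
    ∫ y in 𝒬, f (x - y) = ∫ y in 𝒬, f y := by
  rw [← setIntegral_cube_reflect, ← hf.setIntegral_comp_add (x - 1)]
  congr 1
  ext y
  congr 1
  abel

lemma ZPer.setIntegral_eq_zero_of_odd {f : V3 → ℝ} (hf : ZPer f) (hodd : ∀ x, f (-x) = -f x) :
    ∫ x in 𝒬, f x = 0 := by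
  have h := hf.setIntegral_comp_sub_left 0
  simp only [zero_sub, hodd, integral_neg] at h
  linarith

/-- The product of two copies of Lebesgue measure on the unit cube. -/
abbrev cubeSq : Measure (V3 × V3) :=
  (volume.restrict (Set.Icc (0 : V3) 1)).prod (volume.restrict (Set.Icc (0 : V3) 1))

lemma cubeSq_eq : cubeSq = volume.restrict (𝒬 ×ˢ 𝒬) := by
  rw [cubeSq, Measure.prod_restrict]; rfl

lemma Continuous.integrable_cubeSq {F : V3 × V3 → ℝ} (hF : Continuous F) :
    Integrable F cubeSq := by
  rw [cubeSq_eq]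
  exact hF.continuousOn.integrableOn_compact (isCompact_Icc.prod isCompact_Icc)

lemma Continuous.integrable_cube {F : V3 → ℝ} (hF : Continuous F) :
    Integrable F (volume.restrict 𝒬) :=
  hF.continuousOn.integrableOn_compact isCompact_Icc

lemma Continuous.integral_cubeSq {F : V3 × V3 → ℝ} (hF : Continuous F) :
    ∫ p, F p ∂cubeSq = ∫ x in 𝒬, ∫ y in 𝒬, F (x, y) :=
  integral_prod F hF.integrable_cubeSq

lemma Continuous.integral_cubeSq_symm {F : V3 × V3 → ℝ} (hF : Continuous F) :
    ∫ p, F p ∂cubeSq = ∫ y in 𝒬, ∫ x in 𝒬, F (x, y) :=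
  integral_prod_symm F hF.integrable_cubeSq

lemma integral_cubeSq_swap (F : V3 × V3 → ℝ) :
    ∫ p, F p.swap ∂cubeSq = ∫ p, F p ∂cubeSq :=
  integral_prod_swap F

lemma continuous_grad3 {f : V3 → ℝ} (hf : ContDiff ℝ (⊤ : ℕ∞) f) : Continuous (grad3 f) :=
  continuous_pi fun i => continuous_pd i hf

lemma Continuous.dot3 {X : Type*} [TopologicalSpace X] {a b : X → V3} (ha : Continuous a)
    (hb : Continuous b) : Continuous fun x => dot3 (a x) (b x) :=
  continuous_finsetSum _ fun i _ =>
    ((continuous_apply i).comp ha).mul ((continuous_apply i).comp hb)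

lemma grad3_comp_sub (f : V3 → ℝ) (y x : V3) :
    grad3 (fun z => f (z - y)) x = grad3 f (x - y) :=
  funext fun i => pd_comp_sub i f y x

lemma grad3_neg_of_even {f : V3 → ℝ} (hf : ∀ x, f (-x) = f x) (x : V3) :
    grad3 f (-x) = -grad3 f x :=
  funext fun i => pd_neg_of_even i hf x

lemma dot3_neg_right (a b : V3) : dot3 a (-b) = -dot3 a b := by
  simp [_root_.dot3]

lemma dot3_sub_left (a b c : V3) : dot3 (a - b) c = dot3 a c - dot3 b c := by
  simp [_root_.dot3, sub_mul]

/-- Periodic even smooth functions, used as convolution kernels. -/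
structure IsEvenKernel (K : V3 → ℝ) : Prop where
  smooth : ContDiff ℝ (⊤ : ℕ∞) K
  per : ZPer K
  even : ∀ x, K (-x) = K x

namespace IsEvenKernel

variable {K : V3 → ℝ}

lemma grad3_sub_comm (hK : IsEvenKernel K) (x y : V3) :
    grad3 K (x - y) = -grad3 K (y - x) := by
  rw [← neg_sub, grad3_neg_of_even hK.even]

lemma integral_dot3_grad3_sub (hK : IsEvenKernel K) (a x : V3) :
    ∫ y in 𝒬, dot3 a (grad3 K (x - y)) = 0 := by
  have hc : ∀ i, Continuous fun y : V3 => a i * grad3 K (x - y) i := fun i =>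
    continuous_const.mul ((continuous_pd i hK.smooth).comp (by fun_prop))
  simp only [dot3]
  rw [integral_finsetSum _ fun i _ => (hc i).integrable_cube]
  refine Finset.sum_eq_zero fun i _ => ?_
  rw [integral_const_mul]
  have h : ∫ y in 𝒬, pd i K (x - y) = 0 := by
    rw [(hK.per.pd i).setIntegral_comp_sub_left,
      (hK.per.pd i).setIntegral_eq_zero_of_odd (pd_neg_of_even i hK.even)]
  exact mul_eq_zero_of_right _ h

lemma smooth_comp_sub (hK : IsEvenKernel K) (y : V3) :
    ContDiff ℝ (⊤ : ℕ∞) fun x => K (x - y) :=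
  hK.smooth.comp (contDiff_id.sub contDiff_const)

/-- Symmetrisation of the transport flux of a divergence-free field `u`: only increments of
`r` and `u` enter. -/
lemma two_mul_flux (hK : IsEvenKernel K) {r : V3 → ℝ} {u : V3 → V3}
    (hr : Continuous r) (hu : Continuous u)
    (hdiv : ∀ φ : V3 → ℝ, ContDiff ℝ (⊤ : ℕ∞) φ → ZPer φ →
      ∫ x in 𝒬, dot3 (u x) (grad3 φ x) = 0) :
    2 * ∫ p, r p.1 * r p.2 * dot3 (u p.1) (grad3 K (p.1 - p.2)) ∂cubeSq =
      -(1 / 2) * ∫ p, (r p.1 - r p.2) ^ 2 * dot3 (u p.1 - u p.2) (grad3 K (p.1 - p.2))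
        ∂cubeSq := by
  have hr1 : Continuous fun p : V3 × V3 => r p.1 := hr.comp continuous_fst
  have hr2 : Continuous fun p : V3 × V3 => r p.2 := hr.comp continuous_snd
  have hG : Continuous fun p : V3 × V3 => grad3 K (p.1 - p.2) :=
    (continuous_grad3 hK.smooth).comp (by fun_prop)
  have hd1 : Continuous fun p : V3 × V3 => dot3 (u p.1) (grad3 K (p.1 - p.2)) :=
    (hu.comp continuous_fst).dot3 hG
  have hd2 : Continuous fun p : V3 × V3 => dot3 (u p.2) (grad3 K (p.1 - p.2)) :=
    (hu.comp continuous_snd).dot3 hG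
  have hdiv1 : ∀ y, ∫ x in 𝒬, dot3 (u x) (grad3 K (x - y)) = 0 := fun y => by
    simpa only [grad3_comp_sub] using hdiv _ (hK.smooth_comp_sub y) (hK.per.comp_sub y)
  have hdiv2 : ∀ x, ∫ y in 𝒬, dot3 (u y) (grad3 K (x - y)) = 0 := fun x => by
    simp only [hK.grad3_sub_comm x, dot3_neg_right, integral_neg, hdiv1, neg_zero]
  have c11 : Continuous fun p : V3 × V3 => r p.1 ^ 2 * dot3 (u p.1) (grad3 K (p.1 - p.2)) :=
    (hr1.pow 2).mul hd1
  have c12 : Continuous fun p : V3 × V3 => r p.1 ^ 2 * dot3 (u p.2) (grad3 K (p.1 - p.2)) :=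
    (hr1.pow 2).mul hd2
  have h11 : ∫ p, r p.1 ^ 2 * dot3 (u p.1) (grad3 K (p.1 - p.2)) ∂cubeSq = 0 := by
    rw [c11.integral_cubeSq]
    simp only [integral_const_mul, hK.integral_dot3_grad3_sub, mul_zero, integral_zero]
  have h12 : ∫ p, r p.1 ^ 2 * dot3 (u p.2) (grad3 K (p.1 - p.2)) ∂cubeSq = 0 := by
    rw [c12.integral_cubeSq]
    simp only [integral_const_mul, hdiv2, mul_zero, integral_zero]
  have hswap : ∀ F : ℝ → ℝ → ℝ, (∫ p, F (r p.1) (r p.2) *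
      dot3 (u p.2) (grad3 K (p.1 - p.2)) ∂cubeSq) =
      - ∫ p, F (r p.2) (r p.1) * dot3 (u p.1) (grad3 K (p.1 - p.2)) ∂cubeSq := fun F => by
    rw [← integral_cubeSq_swap, ← integral_neg]
    congr 1
    ext p
    simp only [Prod.fst_swap, Prod.snd_swap, hK.grad3_sub_comm p.2, dot3_neg_right, mul_neg]
  have h22 : ∫ p, r p.2 ^ 2 * dot3 (u p.2) (grad3 K (p.1 - p.2)) ∂cubeSq = 0 := by
    rw [hswap fun _ b => b ^ 2, h11, neg_zero]
  have h21 : ∫ p, r p.2 ^ 2 * dot3 (u p.1) (grad3 K (p.1 - p.2)) ∂cubeSq = 0 := by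
    rw [← neg_eq_zero, ← hswap fun a _ => a ^ 2, h12]
  have hx : ∫ p, r p.1 * r p.2 * dot3 (u p.2) (grad3 K (p.1 - p.2)) ∂cubeSq =
      - ∫ p, r p.1 * r p.2 * dot3 (u p.1) (grad3 K (p.1 - p.2)) ∂cubeSq := by
    rw [hswap fun a b => a * b]
    simp only [mul_comm]
  have hexp : (fun p : V3 × V3 => (r p.1 - r p.2) ^ 2 *
      dot3 (u p.1 - u p.2) (grad3 K (p.1 - p.2))) = fun p =>
      (r p.1 ^ 2 * dot3 (u p.1) (grad3 K (p.1 - p.2)) -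
        r p.1 ^ 2 * dot3 (u p.2) (grad3 K (p.1 - p.2))) +
      (r p.2 ^ 2 * dot3 (u p.1) (grad3 K (p.1 - p.2)) -
        r p.2 ^ 2 * dot3 (u p.2) (grad3 K (p.1 - p.2))) -
      2 * (r p.1 * r p.2 * dot3 (u p.1) (grad3 K (p.1 - p.2)) -
        r p.1 * r p.2 * dot3 (u p.2) (grad3 K (p.1 - p.2))) := by
    ext p
    rw [dot3_sub_left]
    ring
  rw [hexp, integral_sub, integral_add, integral_sub, integral_sub, integral_const_mul,
    integral_sub, h11, h12, h21, h22, hx]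
  · ring
  all_goals exact Continuous.integrable_cubeSq (by fun_prop)

/-- The smoothed energy differs from the energy by a quadratic expression in increments. -/
lemma energy_eq (hK : IsEvenKernel K) {r : V3 → ℝ} (hr : Continuous r) :
    ∫ p, K (p.1 - p.2) * (r p.1 * r p.2) ∂cubeSq =
      (∫ x in 𝒬, K x) * (∫ x in 𝒬, r x ^ 2) -
        (1 / 2) * ∫ p, K (p.1 - p.2) * (r p.1 - r p.2) ^ 2 ∂cubeSq := by
  have hKc : Continuous K := hK.smooth.continuous
  have c1 : Continuous fun p : V3 × V3 => K (p.1 - p.2) * r p.1 ^ 2 := by fun_prop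
  have c2 : Continuous fun p : V3 × V3 => K (p.1 - p.2) * r p.2 ^ 2 := by fun_prop
  have h1 : ∫ p, K (p.1 - p.2) * r p.1 ^ 2 ∂cubeSq =
      (∫ x in 𝒬, K x) * (∫ x in 𝒬, r x ^ 2) := by
    rw [c1.integral_cubeSq]
    simp only [integral_mul_const, hK.per.setIntegral_comp_sub_left, integral_const_mul]
  have h2 : ∫ p, K (p.1 - p.2) * r p.2 ^ 2 ∂cubeSq =
      (∫ x in 𝒬, K x) * (∫ x in 𝒬, r x ^ 2) := by
    rw [c2.integral_cubeSq_symm]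
    simp only [integral_mul_const, hK.per.setIntegral_comp_sub, integral_const_mul]
  have hexp : (fun p : V3 × V3 => K (p.1 - p.2) * (r p.1 - r p.2) ^ 2) = fun p =>
      (K (p.1 - p.2) * r p.1 ^ 2 + K (p.1 - p.2) * r p.2 ^ 2) -
        2 * (K (p.1 - p.2) * (r p.1 * r p.2)) := by
    ext p
    ring
  rw [hexp, integral_sub, integral_add, integral_const_mul, h1, h2]
  · ring
  all_goals exact Continuous.integrable_cubeSq (by fun_prop)

end IsEvenKernel

/-- Even periodic kernels concentrated within distance `ε` of `ℤ³`, with gradient of size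
`M / ε` in `L¹` relative to their mass. -/
structure IsMollifier (K : V3 → ℝ) (ε M : ℝ) : Prop extends IsEvenKernel K where
  nonneg : ∀ x, 0 ≤ K x
  mass_pos : 0 < ∫ x in Set.Icc (0 : V3) 1, K x
  eq_zero : ∀ x, (∀ n : Fin 3 → ℤ, ε < ‖x - fun i => (n i : ℝ)‖) → K x = 0
  pd_eq_zero : ∀ i x, (∀ n : Fin 3 → ℤ, ε < ‖x - fun i => (n i : ℝ)‖) → pd i K x = 0
  integral_pd_le : ∀ i, ∫ x in Set.Icc (0 : V3) 1, |pd i K x| ≤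
    M / ε * ∫ x in Set.Icc (0 : V3) 1, K x

lemma integral_cube_const (c : ℝ) : ∫ _ in 𝒬, c = c := by
  have : volume.real 𝒬 = 1 := by
    rw [Measure.real, Real.volume_Icc_pi]
    simp
  rw [setIntegral_const, this, one_smul]

lemma ZPer.integral_cubeSq_sub {f : V3 → ℝ} (hf : ZPer f) (hc : Continuous f) :
    ∫ p, f (p.1 - p.2) ∂cubeSq = ∫ x in 𝒬, f x := by
  have hc' : Continuous fun p : V3 × V3 => f (p.1 - p.2) := by fun_prop
  rw [hc'.integral_cubeSq]
  simp only [hf.setIntegral_comp_sub_left, integral_cube_const]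

lemma norm_sub_le_of_near_lattice {E : Type*} [SeminormedAddCommGroup E] {f : V3 → E}
    {C a ε : ℝ} (hC : 0 ≤ C) (ha : 0 ≤ a)
    (hper : ∀ (x : V3) (n : Fin 3 → ℤ), f (x + fun i => (n i : ℝ)) = f x)
    (hf : ∀ x y, ‖f x - f y‖ ≤ C * ‖x - y‖ ^ a) {x y : V3} {n : Fin 3 → ℤ}
    (h : ‖x - y - fun i => (n i : ℝ)‖ ≤ ε) : ‖f x - f y‖ ≤ C * ε ^ a := by
  rw [← hper y n]
  refine (hf _ _).trans ?_
  rw [← sub_sub]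
  gcongr

namespace IsMollifier

variable {K : V3 → ℝ} {ε M : ℝ}

lemma abs_flux_le (hK : IsMollifier K ε M) (hε : 0 < ε) {r : V3 → ℝ} {u : V3 → V3}
    (hr : Continuous r) (hu : Continuous u)
    (hdiv : ∀ φ : V3 → ℝ, ContDiff ℝ (⊤ : ℕ∞) φ → ZPer φ →
      ∫ x in 𝒬, dot3 (u x) (grad3 φ x) = 0)
    (hrper : ZPer r) (huper : ∀ (x : V3) (n : Fin 3 → ℤ), u (x + fun i => (n i : ℝ)) = u x)
    {C D a b : ℝ} (hC : 0 ≤ C) (hD : 0 ≤ D) (ha : 0 ≤ a) (hb : 0 ≤ b)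
    (hrH : ∀ x y, ‖r x - r y‖ ≤ C * ‖x - y‖ ^ a) (huH : ∀ x y, ‖u x - u y‖ ≤ D * ‖x - y‖ ^ b) :
    |2 * ∫ p, r p.1 * r p.2 * dot3 (u p.1) (grad3 K (p.1 - p.2)) ∂cubeSq| ≤
      2 * C ^ 2 * D * M * ε ^ (2 * a + b - 1) * ∫ x in 𝒬, K x := by
  have hpd : ∀ i, Continuous (pd i K) := fun i => continuous_pd i hK.smooth
  have hbound : ∀ p : V3 × V3,
      ‖(r p.1 - r p.2) ^ 2 * dot3 (u p.1 - u p.2) (grad3 K (p.1 - p.2))‖ ≤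
        ∑ i, (C * ε ^ a) ^ 2 * (D * ε ^ b) * |pd i K (p.1 - p.2)| := by
    intro p
    rw [dot3, Finset.mul_sum]
    refine (norm_sum_le _ _).trans (Finset.sum_le_sum fun i _ => ?_)
    by_cases h : ∀ n : Fin 3 → ℤ, ε < ‖p.1 - p.2 - fun i => (n i : ℝ)‖
    · simp [grad3, hK.pd_eq_zero i _ h]
    · push Not at h
      obtain ⟨n, hn⟩ := h
      have h1 := norm_sub_le_of_near_lattice hC ha hrper hrH hn
      have h2 := norm_sub_le_of_near_lattice hD hb huper huH hn
      have h3 := (norm_le_pi_norm (u p.1 - u p.2) i).trans h2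
      rw [norm_mul, norm_mul, norm_pow, ← mul_assoc]
      exact mul_le_mul (by gcongr) le_rfl (norm_nonneg _) (by positivity)
  have hsum : ∫ p, ∑ i, (C * ε ^ a) ^ 2 * (D * ε ^ b) * |pd i K (p.1 - p.2)| ∂cubeSq ≤
      ∑ _i : Fin 3, (C * ε ^ a) ^ 2 * (D * ε ^ b) * (M / ε * ∫ x in 𝒬, K x) := by
    rw [integral_finsetSum _ fun i _ => Continuous.integrable_cubeSq (by fun_prop)]
    refine Finset.sum_le_sum fun i _ => ?_
    rw [integral_const_mul]
    have h : ZPer fun x => |pd i K x| := fun x n => by simp only [hK.per.pd i x n]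
    rw [h.integral_cubeSq_sub (by fun_prop)]
    gcongr
    exact hK.integral_pd_le i
  have hmain := (norm_integral_le_of_norm_le (Continuous.integrable_cubeSq (by fun_prop))
    (Filter.Eventually.of_forall hbound)).trans hsum
  have hpow : ε ^ (2 * a + b - 1) = (ε ^ a) ^ 2 * ε ^ b / ε := by
    rw [Real.rpow_sub_one hε.ne', Real.rpow_add hε, mul_comm 2 a, Real.rpow_mul hε.le,
      Real.rpow_two]
  have hM : 0 ≤ M * ∫ x in 𝒬, K x := by
    have h := (integral_nonneg fun x => abs_nonneg (pd 0 K x)).trans (hK.integral_pd_le 0)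
    have h' := mul_nonneg hε.le h
    rwa [← mul_assoc, mul_div_cancel₀ _ hε.ne'] at h'
  rw [hK.two_mul_flux hr hu hdiv, abs_mul, hpow]
  rw [Finset.sum_const, Finset.card_univ, Fintype.card_fin, nsmul_eq_mul, Real.norm_eq_abs]
    at hmain
  have hnn : 0 ≤ C ^ 2 * D * ((ε ^ a) ^ 2 * ε ^ b / ε) * (M * ∫ x in 𝒬, K x) := by positivity
  have heq : ((3 : ℕ) : ℝ) * ((C * ε ^ a) ^ 2 * (D * ε ^ b) * (M / ε * ∫ x in 𝒬, K x)) =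
      3 * (C ^ 2 * D * ((ε ^ a) ^ 2 * ε ^ b / ε) * (M * ∫ x in 𝒬, K x)) := by
    push_cast; ring
  rw [heq] at hmain
  have habs : |(-(1 / 2) : ℝ)| = 1 / 2 := by norm_num
  rw [habs]
  nlinarith [hmain, hnn]

lemma abs_energy_sub_le (hK : IsMollifier K ε M) (hε : 0 < ε) {r : V3 → ℝ}
    (hr : Continuous r) (hrper : ZPer r) {C a : ℝ} (hC : 0 ≤ C) (ha : 0 ≤ a)
    (hrH : ∀ x y, ‖r x - r y‖ ≤ C * ‖x - y‖ ^ a) :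
    |∫ p, K (p.1 - p.2) * (r p.1 * r p.2) ∂cubeSq - (∫ x in 𝒬, K x) * (∫ x in 𝒬, r x ^ 2)| ≤
      C ^ 2 * ε ^ (2 * a) * ∫ x in 𝒬, K x := by
  have hKc : Continuous K := hK.smooth.continuous
  have hbound : ∀ p : V3 × V3, ‖K (p.1 - p.2) * (r p.1 - r p.2) ^ 2‖ ≤
      (C * ε ^ a) ^ 2 * K (p.1 - p.2) := by
    intro p
    by_cases h : ∀ n : Fin 3 → ℤ, ε < ‖p.1 - p.2 - fun i => (n i : ℝ)‖
    · simp [hK.eq_zero _ h]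
    · push Not at h
      obtain ⟨n, hn⟩ := h
      have h1 := norm_sub_le_of_near_lattice hC ha hrper hrH hn
      rw [norm_mul, norm_pow, mul_comm, Real.norm_of_nonneg (hK.nonneg _)]
      have := hK.nonneg (p.1 - p.2)
      gcongr
  have hmain := norm_integral_le_of_norm_le (Continuous.integrable_cubeSq (by fun_prop))
    (Filter.Eventually.of_forall hbound)
  rw [integral_const_mul, hK.per.integral_cubeSq_sub hKc, Real.norm_eq_abs] at hmain
  rw [hK.energy_eq hr, sub_sub_cancel_left, abs_neg, abs_mul, mul_comm 2 a,
    Real.rpow_mul hε.le, Real.rpow_two, abs_of_pos one_half_pos, ← mul_pow]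
  have := abs_nonneg (∫ p, K (p.1 - p.2) * (r p.1 - r p.2) ^ 2 ∂cubeSq)
  linarith

end IsMollifier

/-- A smooth periodic function comparable to the squared distance to `ℤ³`. -/
def latticeGauge (x : V3) : ℝ := ∑ i, (1 - Real.cos (2 * Real.pi * x i))

lemma contDiff_latticeGauge : ContDiff ℝ (⊤ : ℕ∞) latticeGauge := by
  unfold latticeGauge
  fun_prop

lemma latticeGauge_add_int (x : V3) (n : Fin 3 → ℤ) :
    latticeGauge (x + fun i => (n i : ℝ)) = latticeGauge x := by
  refine Finset.sum_congr rfl fun i _ => ?_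
  rw [Pi.add_apply, mul_add, mul_comm (2 * Real.pi) (n i : ℝ), Real.cos_add_int_mul_two_pi]

lemma latticeGauge_neg (x : V3) : latticeGauge (-x) = latticeGauge x := by
  simp [latticeGauge]

lemma pd_latticeGauge (i : Fin 3) (x : V3) :
    pd i latticeGauge x = 2 * Real.pi * Real.sin (2 * Real.pi * x i) := by
  have h : ∀ j : Fin 3, HasFDerivAt (fun x : V3 => 1 - Real.cos (2 * Real.pi * x j))
      ((2 * Real.pi * Real.sin (2 * Real.pi * x j)) •
        (ContinuousLinearMap.proj j : V3 →L[ℝ] ℝ)) x := by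
    intro j
    have h1 : HasDerivAt (fun s : ℝ => 1 - Real.cos (2 * Real.pi * s))
        (2 * Real.pi * Real.sin (2 * Real.pi * x j)) (x j) := by
      have h2 := ((hasDerivAt_id (x j)).const_mul (2 * Real.pi)).cos.const_sub 1
      refine h2.congr_deriv ?_
      simp only [id]
      ring
    exact HasDerivAt.comp_hasFDerivAt (f := fun x : V3 => x j) x h1 (hasFDerivAt_apply j x)
  have hs : HasFDerivAt latticeGauge _ x := HasFDerivAt.fun_sum (u := Finset.univ) fun j _ => h j
  rw [pd, hs.fderiv]
  simp [Pi.single_apply]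

lemma one_sub_cos_le_latticeGauge (i : Fin 3) (x : V3) :
    1 - Real.cos (2 * Real.pi * x i) ≤ latticeGauge x :=
  Finset.single_le_sum (f := fun i => 1 - Real.cos (2 * Real.pi * x i))
    (fun _ _ => sub_nonneg.2 (Real.cos_le_one _)) (Finset.mem_univ i)

lemma abs_sub_round_le_of_latticeGauge_le {x : V3} {ε : ℝ} (hε : 0 ≤ ε)
    (h : latticeGauge x ≤ ε ^ 2) (i : Fin 3) : |x i - round (x i)| ≤ ε := by
  have h1 := (one_sub_cos_le_latticeGauge i x).trans h
  set d := x i - round (x i) with hd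
  have hcos : Real.cos (2 * Real.pi * x i) = Real.cos (2 * Real.pi * d) := by
    rw [hd, mul_sub, mul_comm (2 * Real.pi) (round (x i) : ℝ), Real.cos_sub_int_mul_two_pi]
  have hd2 : |d| ≤ 1 / 2 := abs_sub_round _
  have hpi := Real.pi_pos
  have h2 := Real.cos_le_one_sub_mul_cos_sq (x := 2 * Real.pi * d) (by
    rw [abs_mul, abs_of_pos (by positivity)]
    nlinarith)
  have h3 : 2 / Real.pi ^ 2 * (2 * Real.pi * d) ^ 2 = 8 * d ^ 2 := by
    field_simp
    ring
  rw [h3, ← hcos] at h2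
  refine abs_le_of_sq_le_sq ?_ hε
  nlinarith [sq_nonneg d]

lemma abs_pd_latticeGauge_le {x : V3} {ε : ℝ} (hε : 0 ≤ ε)
    (h : latticeGauge x ≤ ε ^ 2) (i : Fin 3) :
    |pd i latticeGauge x| ≤ 4 * Real.pi * ε := by
  have h1 := (one_sub_cos_le_latticeGauge i x).trans h
  have h2 : |Real.sin (2 * Real.pi * x i)| ≤ 2 * ε := by
    refine abs_le_of_sq_le_sq ?_ (by positivity)
    nlinarith [Real.sin_sq_add_cos_sq (2 * Real.pi * x i), Real.cos_le_one (2 * Real.pi * x i),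
      Real.neg_one_le_cos (2 * Real.pi * x i)]
  rw [pd_latticeGauge, abs_mul, abs_of_pos Real.two_pi_pos]
  nlinarith [Real.pi_pos]

lemma latticeGauge_le_of_mem_Icc {x : V3} {ε : ℝ} (hε : 0 ≤ ε)
    (hx : x ∈ Set.Icc (0 : V3) fun _ => ε / 12) : latticeGauge x ≤ ε ^ 2 / 2 := by
  have h : ∀ i ∈ Finset.univ, 1 - Real.cos (2 * Real.pi * x i) ≤ ε ^ 2 / 6 := by
    intro i _
    have h1 := Real.one_sub_sq_div_two_le_cos (x := 2 * Real.pi * x i)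
    have h2 : 2 * Real.pi * x i ≤ ε * (8 / 15) := by
      have h0 : (0 : ℝ) ≤ x i := hx.1 i
      have h3 : x i ≤ ε / 12 := hx.2 i
      nlinarith [Real.pi_pos, Real.pi_lt_d2]
    have h3 : 0 ≤ 2 * Real.pi * x i := mul_nonneg Real.two_pi_pos.le (hx.1 i)
    nlinarith
  have h' := Finset.sum_le_card_nsmul _ _ _ h
  rw [Finset.card_univ, Fintype.card_fin, nsmul_eq_mul] at h'
  push_cast at h'
  rw [latticeGauge]
  linarith

lemma exists_mollifier : ∃ M : ℝ, ∀ ε : ℝ, 0 < ε → ε ≤ 1 → ∃ K : V3 → ℝ, IsMollifier K ε M := by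
  let h : ContDiffBump (0 : ℝ) := ⟨1 / 2, 1, by norm_num, by norm_num⟩
  have hsm : ContDiff ℝ (⊤ : ℕ∞) h := h.contDiff
  obtain ⟨B, hB⟩ := h.hasCompactSupport.deriv.exists_bound_of_continuous
    (hsm.continuous_deriv (by simp))
  have hB0 : 0 ≤ B := (norm_nonneg _).trans (hB 0)
  have hzero : ∀ s : ℝ, 1 < s → h s = 0 := fun s hs => h.zero_of_le_dist (by
    rw [Real.dist_eq, sub_zero]; exact hs.le.trans (le_abs_self s))
  have hdzero : ∀ s : ℝ, 1 < s → deriv h s = 0 := fun s hs => by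
    by_contra hne
    have := support_deriv_subset (Function.mem_support.2 hne)
    rw [h.tsupport_eq, Metric.mem_closedBall, Real.dist_eq, sub_zero] at this
    exact absurd (le_abs_self s) (not_le.2 (lt_of_le_of_lt this hs))
  refine ⟨4 * Real.pi * B * (8 * 12 ^ 3), fun ε hε hε1 => ?_⟩
  have hε2 : 0 < ε ^ 2 := by positivity
  let K : V3 → ℝ := fun x => h (latticeGauge x / ε ^ 2)
  have hKsm : ContDiff ℝ (⊤ : ℕ∞) K := hsm.comp (contDiff_latticeGauge.div_const _)
  have hKc : Continuous K := hKsm.continuous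
  have hKnn : ∀ x, 0 ≤ K x := fun x => h.nonneg
  have hpdK : ∀ i x, pd i K x =
      deriv h (latticeGauge x / ε ^ 2) * (pd i latticeGauge x / ε ^ 2) := by
    intro i x
    have h1 : HasFDerivAt latticeGauge (fderiv ℝ latticeGauge x) x :=
      (contDiff_latticeGauge.differentiable (by simp) x).hasFDerivAt
    have h2 : HasFDerivAt (fun x => latticeGauge x / ε ^ 2)
        ((ε ^ 2)⁻¹ • fderiv ℝ latticeGauge x) x := by
      simpa only [div_eq_inv_mul] using h1.const_mul (ε ^ 2)⁻¹
    have h3 : HasFDerivAt K _ x :=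
      ((hsm.differentiable (by simp) _).hasDerivAt).comp_hasFDerivAt x h2
    rw [pd, h3.fderiv]
    simp only [smul_apply, smul_eq_mul, pd]
    ring
  have hfar : ∀ x : V3, (∀ n : Fin 3 → ℤ, ε < ‖x - fun i => (n i : ℝ)‖) →
      1 < latticeGauge x / ε ^ 2 := by
    intro x hx
    by_contra! hle
    rw [div_le_one hε2] at hle
    refine absurd (hx fun i => round (x i)) (not_lt.2 ((pi_norm_le_iff_of_nonneg hε.le).2 ?_))
    exact abs_sub_round_le_of_latticeGauge_le hε.le hle
  have hbox : (ε / 12) ^ 3 ≤ ∫ x in 𝒬, K x := by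
    have hsub : Set.Icc (0 : V3) (fun _ => ε / 12) ⊆ 𝒬 :=
      Set.Icc_subset_Icc_right fun i => by simp only [Pi.one_apply]; linarith
    calc (ε / 12) ^ 3 = ∫ _ in Set.Icc (0 : V3) (fun _ => ε / 12), (1 : ℝ) := by
          rw [setIntegral_const, Measure.real, Real.volume_Icc_pi]
          simp [ENNReal.toReal_ofReal (show 0 ≤ ε / 12 by positivity)]
      _ = ∫ x in Set.Icc (0 : V3) (fun _ => ε / 12), K x := by
          refine setIntegral_congr_fun measurableSet_Icc fun x hx => ?_
          refine (h.one_of_mem_closedBall ?_).symm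
          have h1 := latticeGauge_le_of_mem_Icc hε.le hx
          have h0 : 0 ≤ latticeGauge x :=
            Finset.sum_nonneg fun _ _ => sub_nonneg.2 (Real.cos_le_one _)
          rw [Metric.mem_closedBall, Real.dist_eq, sub_zero, abs_of_nonneg (by positivity),
            div_le_iff₀ hε2]
          change _ ≤ 1 / 2 * ε ^ 2
          linarith
      _ ≤ ∫ x in 𝒬, K x := setIntegral_mono_set hKc.integrable_cube
          (Filter.Eventually.of_forall hKnn) hsub.eventuallyLE
  refine ⟨K, ⟨hKsm, fun x n => ?_, fun x => ?_⟩, hKnn,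
    (by positivity : 0 < (ε / 12) ^ 3).trans_le hbox, fun x hx => hzero _ (hfar x hx),
    fun i x hx => ?_, fun i => ?_⟩
  · simp only [K, latticeGauge_add_int]
  · simp only [K, latticeGauge_neg]
  · rw [hpdK, hdzero _ (hfar x hx), zero_mul]
  · let A : Set ℝ := Set.Icc 0 ε ∪ Set.Icc (1 - ε) 1
    let S : Set V3 := Set.univ.pi fun _ => A
    have hA : MeasurableSet A := measurableSet_Icc.union measurableSet_Icc
    have hS : MeasurableSet S := MeasurableSet.univ_pi fun _ => hA
    have hvolA : volume A ≤ ENNReal.ofReal (2 * ε) := by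
      refine (measure_union_le _ _).trans ?_
      rw [Real.volume_Icc, Real.volume_Icc, ← ENNReal.ofReal_add (by linarith) (by linarith)]
      exact ENNReal.ofReal_le_ofReal (by linarith)
    have hvolS : (volume.restrict 𝒬).real S ≤ 8 * ε ^ 3 := by
      have h1 : (volume.restrict 𝒬) S ≤ ENNReal.ofReal (8 * ε ^ 3) := by
        refine (Measure.restrict_apply_le _ _).trans ?_
        rw [volume_pi_pi, Finset.prod_const, Finset.card_univ, Fintype.card_fin,
          show 8 * ε ^ 3 = (2 * ε) ^ 3 by ring, ENNReal.ofReal_pow (by positivity)]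
        gcongr
      exact ENNReal.toReal_le_of_le_ofReal (by positivity) h1
    have hpt : ∀ x ∈ 𝒬, |pd i K x| ≤ S.indicator (fun _ => 4 * Real.pi * B / ε) x := by
      intro x hx
      rw [hpdK]
      by_cases hg : 1 < latticeGauge x / ε ^ 2
      · rw [hdzero _ hg, zero_mul, abs_zero]
        exact Set.indicator_nonneg (fun _ _ => by positivity) _
      · rw [not_lt, div_le_one hε2] at hg
        have hxS : x ∈ S := by
          intro j _
          have h1 := abs_le.1 (abs_sub_round_le_of_latticeGauge_le hε.le hg j)
          have hx0 : 0 ≤ x j := hx.1 j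
          have hx1 : x j ≤ 1 := hx.2 j
          rcases le_or_gt (round (x j)) 0 with hn | hn
          · have : (round (x j) : ℝ) ≤ 0 := by exact_mod_cast hn
            exact Or.inl ⟨hx0, by linarith⟩
          · have : (1 : ℝ) ≤ round (x j) := by exact_mod_cast hn
            exact Or.inr ⟨by linarith, hx1⟩
        rw [Set.indicator_of_mem hxS, abs_mul, abs_div, abs_of_pos hε2]
        calc |deriv h (latticeGauge x / ε ^ 2)| * (|pd i latticeGauge x| / ε ^ 2)
            ≤ B * (4 * Real.pi * ε / ε ^ 2) := by
              gcongr
              · exact hB _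
              · exact abs_pd_latticeGauge_le hε.le hg i
          _ = 4 * Real.pi * B / ε := by field_simp
    calc ∫ x in 𝒬, |pd i K x|
        ≤ ∫ x in 𝒬, S.indicator (fun _ => 4 * Real.pi * B / ε) x :=
          setIntegral_mono_on (Continuous.integrable_cube (continuous_pd i hKsm).abs)
            ((continuous_const.integrable_cube).indicator hS) measurableSet_Icc hpt
      _ = (volume.restrict 𝒬).real S * (4 * Real.pi * B / ε) := by
          rw [integral_indicator_const _ hS, smul_eq_mul]
      _ ≤ 8 * ε ^ 3 * (4 * Real.pi * B / ε) := by gcongr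
      _ = 4 * Real.pi * B * (8 * 12 ^ 3) / ε * (ε / 12) ^ 3 := by ring
      _ ≤ _ := by gcongr

lemma continuous_cube_integral {X : Type*} [TopologicalSpace X] [FirstCountableTopology X]
    [LocallyCompactSpace X] {f : X → V3 → ℝ} (hf : Continuous fun p : X × V3 => f p.1 p.2) :
    Continuous fun t => ∫ x in 𝒬, f t x := by
  have h := continuous_parametric_integral_of_continuous (μ := volume) (f := f) hf
    (isCompact_Icc : IsCompact 𝒬)
  convert h using 1

/-- A function whose increments are integrals of a continuous density that may depend on the
endpoints is Lipschitz with constant any bound of the density on the diagonal. -/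
lemma abs_sub_le_of_increment_eq_integral {T δ : ℝ} {E : ℝ → ℝ} {Φ : ℝ × ℝ × ℝ → ℝ}
    (hΦ : Continuous Φ)
    (hE : ∀ s ∈ Set.Icc 0 T, ∀ t ∈ Set.Icc 0 T, E t - E s = ∫ r in s..t, Φ (r, s, t))
    (hδ : ∀ s ∈ Set.Icc 0 T, |Φ (s, s, s)| ≤ δ) :
    ∀ t ∈ Set.Icc 0 T, |E t - E 0| ≤ δ * t := by
  have hderiv : ∀ s ∈ Set.Icc 0 T, HasDerivWithinAt E (Φ (s, s, s)) (Set.Icc 0 T) s := by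
    intro s hs
    rw [hasDerivWithinAt_iff_isLittleO, Asymptotics.isLittleO_iff]
    intro c hc
    obtain ⟨η, hη, hball⟩ := Metric.continuousAt_iff.1 (hΦ.continuousAt (x := (s, s, s))) c hc
    filter_upwards [inter_mem_nhdsWithin _ (Metric.ball_mem_nhds s hη)] with t ht
    have hint : ∀ a b : ℝ, IntervalIntegrable (fun r => Φ (r, s, t)) volume a b := fun a b =>
      (hΦ.comp (by fun_prop : Continuous fun r : ℝ => (r, s, t))).intervalIntegrable a b
    have heq : E t - E s - (t - s) • Φ (s, s, s) =
        ∫ r in s..t, (Φ (r, s, t) - Φ (s, s, s)) := by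
      rw [intervalIntegral.integral_sub (hint s t) intervalIntegrable_const,
        intervalIntegral.integral_const, hE s hs t ht.1]
    rw [heq, Real.norm_eq_abs (t - s)]
    refine intervalIntegral.norm_integral_le_of_norm_le_const fun r hr => ?_
    have ht' : dist t s < η := ht.2
    have hr' : dist r s < η := by
      refine lt_of_le_of_lt ?_ ht'
      rw [Real.dist_eq, Real.dist_eq]
      exact Set.abs_sub_left_of_mem_uIcc (Set.uIoc_subset_uIcc hr)
    refine (hball ?_).le
    simp only [Prod.dist_eq, dist_self]
    exact max_lt hr' (max_lt hη ht')
  intro t ht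
  simpa using norm_image_sub_le_of_norm_deriv_le_segment' hderiv
    (fun s hs => hδ s (Set.Ico_subset_Icc_self hs)) t ht

lemma IsEvenKernel.abs_energy_sub_le_of_weakSol {K : V3 → ℝ} (hK : IsEvenKernel K) {T δ : ℝ}
    {ρ : ℝ × V3 → ℝ} {v : ℝ × V3 → V3} (hρ : Continuous ρ) (hv : Continuous v)
    (hsol : ∀ ψ : V3 → ℝ, ContDiff ℝ (⊤ : ℕ∞) ψ → ZPer ψ → ∀ t ∈ Set.Icc 0 T,
      ∫ s in (0 : ℝ)..t, ∫ x in 𝒬, ρ (s, x) * dot3 (v (s, x)) (grad3 ψ x) =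
        (∫ x in 𝒬, ρ (t, x) * ψ x) - ∫ x in 𝒬, ρ (0, x) * ψ x)
    (hδ : ∀ s ∈ Set.Icc 0 T, |2 * ∫ p, ρ (s, p.1) * ρ (s, p.2) *
      dot3 (v (s, p.1)) (grad3 K (p.1 - p.2)) ∂cubeSq| ≤ δ) :
    ∀ t ∈ Set.Icc 0 T,
      |∫ p, K (p.1 - p.2) * (ρ (t, p.1) * ρ (t, p.2)) ∂cubeSq -
        ∫ p, K (p.1 - p.2) * (ρ (0, p.1) * ρ (0, p.2)) ∂cubeSq| ≤ δ * t := by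
  have hKc : Continuous K := hK.smooth.continuous
  have hGr : Continuous (grad3 K) := continuous_grad3 hK.smooth
  let G : ℝ × V3 → ℝ := fun q => ∫ x in 𝒬, ρ (q.1, x) * dot3 (v (q.1, x)) (grad3 K (x - q.2))
  have hG : Continuous G := by
    refine continuous_cube_integral (X := ℝ × V3)
      (f := fun q x => ρ (q.1, x) * dot3 (v (q.1, x)) (grad3 K (x - q.2))) ?_
    exact Continuous.mul (by fun_prop) (Continuous.dot3 (by fun_prop) (by fun_prop))
  have hevol : ∀ s ∈ Set.Icc 0 T, ∀ t ∈ Set.Icc 0 T, ∀ y : V3,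
      ∫ x in 𝒬, K (x - y) * (ρ (t, x) - ρ (s, x)) = ∫ r in s..t, G (r, y) := by
    intro s hs t ht y
    have h := fun t ht => hsol (fun x => K (x - y)) (hK.smooth_comp_sub y) (hK.per.comp_sub y) t ht
    simp only [grad3_comp_sub] at h
    have hint : ∀ a b : ℝ, IntervalIntegrable (fun r => G (r, y)) volume a b := fun a b =>
      (hG.comp (by fun_prop : Continuous fun r : ℝ => (r, y))).intervalIntegrable a b
    have h1 : ∫ r in s..t, G (r, y) = (∫ r in (0 : ℝ)..t, G (r, y)) - ∫ r in (0 : ℝ)..s, G (r, y) :=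
      (intervalIntegral.integral_interval_sub_left (hint _ _) (hint _ _)).symm
    rw [h1]
    simp only [G]
    rw [h t ht, h s hs, sub_sub_sub_cancel_right, ← integral_sub
      (Continuous.integrable_cube (by fun_prop)) (Continuous.integrable_cube (by fun_prop))]
    congr 1
    ext x
    ring
  let Φ : ℝ × ℝ × ℝ → ℝ := fun q => ∫ y in 𝒬, (ρ (q.2.2, y) + ρ (q.2.1, y)) * G (q.1, y)
  have hΦ : Continuous Φ := by
    refine continuous_cube_integral (X := ℝ × ℝ × ℝ)
      (f := fun q y => (ρ (q.2.2, y) + ρ (q.2.1, y)) * G (q.1, y)) ?_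
    fun_prop
  refine abs_sub_le_of_increment_eq_integral hΦ
    (E := fun t => ∫ p, K (p.1 - p.2) * (ρ (t, p.1) * ρ (t, p.2)) ∂cubeSq) ?_ ?_
  · intro s hs t ht
    have hsymm : ∫ p, K (p.1 - p.2) * (ρ (s, p.1) * ρ (t, p.2)) ∂cubeSq =
        ∫ p, K (p.1 - p.2) * (ρ (t, p.1) * ρ (s, p.2)) ∂cubeSq := by
      rw [← integral_cubeSq_swap]
      congr 1
      ext p
      rw [Prod.fst_swap, Prod.snd_swap, ← hK.even, neg_sub, mul_comm (ρ (s, p.2))]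
    have hexp : ∫ p, (ρ (t, p.2) + ρ (s, p.2)) *
          (K (p.1 - p.2) * (ρ (t, p.1) - ρ (s, p.1))) ∂cubeSq =
        (∫ p, K (p.1 - p.2) * (ρ (t, p.1) * ρ (t, p.2)) ∂cubeSq -
          ∫ p, K (p.1 - p.2) * (ρ (s, p.1) * ρ (s, p.2)) ∂cubeSq) := by
      have : (fun p : V3 × V3 => (ρ (t, p.2) + ρ (s, p.2)) *
          (K (p.1 - p.2) * (ρ (t, p.1) - ρ (s, p.1)))) = fun p =>
          (K (p.1 - p.2) * (ρ (t, p.1) * ρ (t, p.2)) -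
            K (p.1 - p.2) * (ρ (s, p.1) * ρ (s, p.2))) +
          (K (p.1 - p.2) * (ρ (t, p.1) * ρ (s, p.2)) -
            K (p.1 - p.2) * (ρ (s, p.1) * ρ (t, p.2))) := by
        ext p
        ring
      rw [this, integral_add, integral_sub, integral_sub, hsymm, sub_self, add_zero]
      all_goals exact Continuous.integrable_cubeSq (by fun_prop)
    have hcont : Continuous fun p : V3 × V3 => (ρ (t, p.2) + ρ (s, p.2)) *
        (K (p.1 - p.2) * (ρ (t, p.1) - ρ (s, p.1))) := by fun_prop
    rw [← hexp, hcont.integral_cubeSq_symm]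
    simp only [integral_const_mul, hevol s hs t ht, Φ, ← intervalIntegral.integral_const_mul]
    rw [intervalIntegral_integral_swap]
    have hc : Continuous (Function.uncurry fun (r : ℝ) (y : V3) =>
        (ρ (t, y) + ρ (s, y)) * G (r, y)) := by
      unfold Function.uncurry
      fun_prop
    rw [Measure.prod_restrict]
    exact (hc.continuousOn.integrableOn_compact
      (isCompact_uIcc.prod (isCompact_Icc : IsCompact 𝒬))).mono_set
      (Set.prod_mono Set.uIoc_subset_uIcc le_rfl)
  · intro s hs
    convert hδ s hs using 2
    have hcont : Continuous fun p : V3 × V3 => ρ (s, p.1) * ρ (s, p.2) *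
        dot3 (v (s, p.1)) (grad3 K (p.1 - p.2)) :=
      Continuous.mul (by fun_prop) (Continuous.dot3 (by fun_prop) (by fun_prop))
    rw [hcont.integral_cubeSq_symm, ← integral_const_mul]
    refine integral_congr_ae (Filter.Eventually.of_forall fun y => ?_)
    simp only [G]
    rw [← integral_const_mul, ← integral_const_mul]
    congr 1
    ext x
    ring

lemma HolderOnWith.norm_sub_slice_le {E : Type*} [SeminormedAddCommGroup E] {f : ℝ × V3 → E}
    {C a : ℝ≥0} {I : Set ℝ} (hf : HolderOnWith C a f (I ×ˢ Set.univ)) {t : ℝ} (ht : t ∈ I)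
    (x y : V3) : ‖f (t, x) - f (t, y)‖ ≤ C * ‖x - y‖ ^ (a : ℝ) := by
  have h := hf.dist_le (x := (t, x)) (y := (t, y)) ⟨ht, Set.mem_univ _⟩ ⟨ht, Set.mem_univ _⟩
  simpa [dist_eq_norm, Prod.norm_def] using h

/-- **Energy conservation for Hölder solutions of the transport equation.**
Let `β, bt ∈ (0,1)` with `β + 2bt > 1` and `T > 0`.  If `v ∈ C^β([0,T] × 𝕋³; ℝ³)` is
divergence-free and `ρ ∈ C^{bt}([0,T] × 𝕋³)` is a weak solution of
`∂_t ρ + div (v ρ) = 0`, then for every `t ∈ [0,T]`,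
`∫_{𝕋³} |ρ(t,x)|² dx = ∫_{𝕋³} |ρ(0,x)|² dx`. -/
theorem transport_energy_conservation
    (T : ℝ) (hT : 0 < T) (β bt : ℝ≥0)
    (hβ0 : 0 < β) (hβ1 : β < 1) (hbt0 : 0 < bt) (hbt1 : bt < 1)
    (hreg : 1 < (β : ℝ) + 2 * (bt : ℝ))
    (v : ℝ × V3 → V3) (ρ : ℝ × V3 → ℝ)
    (hvH : ∃ C : ℝ≥0, HolderOnWith C β v (Set.Icc (0:ℝ) T ×ˢ Set.univ))
    (hρH : ∃ C : ℝ≥0, HolderOnWith C bt ρ (Set.Icc (0:ℝ) T ×ˢ Set.univ))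
    (hvper : ZPerSTv v) (hρper : ZPerST ρ)
    (hdiv : WeaklyDivFree v)
    (hsol : IsWeakTransportSol T v ρ) :
    ∀ t ∈ Set.Icc (0 : ℝ) T,
      ∫ x in Set.Icc (0 : V3) 1, (ρ (t, x))^2
        = ∫ x in Set.Icc (0 : V3) 1, (ρ (0, x))^2 := by
  obtain ⟨C, hC⟩ := hρH
  obtain ⟨D, hD⟩ := hvH
  obtain ⟨M, hM⟩ := exists_mollifier
  let π : ℝ → ℝ := fun t => Set.projIcc 0 T hT.le t
  have hπ : ∀ t, π t ∈ Set.Icc 0 T := fun t => (Set.projIcc 0 T hT.le t).2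
  have hπ_of_mem : ∀ t ∈ Set.Icc 0 T, π t = t := fun t ht => by
    simp only [π, Set.projIcc_of_mem hT.le ht]
  have hπc : Continuous fun p : ℝ × V3 => (π p.1, p.2) :=
    (continuous_subtype_val.comp (continuous_projIcc.comp continuous_fst)).prodMk continuous_snd
  let r : ℝ × V3 → ℝ := fun p => ρ (π p.1, p.2)
  let u : ℝ × V3 → V3 := fun p => v (π p.1, p.2)
  have hr : Continuous r :=
    (hC.continuousOn hbt0).comp_continuous hπc fun p => ⟨hπ p.1, Set.mem_univ _⟩
  have hu : Continuous u :=
    (hD.continuousOn hβ0).comp_continuous hπc fun p => ⟨hπ p.1, Set.mem_univ _⟩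
  have hrt : ∀ t, Continuous fun x => r (t, x) := fun t => by fun_prop
  have hut : ∀ t, Continuous fun x => u (t, x) := fun t => by fun_prop
  have hrH : ∀ t x y, ‖r (t, x) - r (t, y)‖ ≤ C * ‖x - y‖ ^ (bt : ℝ) := fun t =>
    hC.norm_sub_slice_le (hπ t)
  have huH : ∀ t x y, ‖u (t, x) - u (t, y)‖ ≤ D * ‖x - y‖ ^ (β : ℝ) := fun t =>
    hD.norm_sub_slice_le (hπ t)
  have hweak : ∀ ψ : V3 → ℝ, ContDiff ℝ (⊤ : ℕ∞) ψ → ZPer ψ → ∀ t ∈ Set.Icc 0 T,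
      ∫ s in (0 : ℝ)..t, ∫ x in 𝒬, r (s, x) * dot3 (u (s, x)) (grad3 ψ x) =
        (∫ x in 𝒬, r (t, x) * ψ x) - ∫ x in 𝒬, r (0, x) * ψ x := by
    intro ψ hψ hper t ht
    have h := hsol (fun p => ψ p.2) (hψ.comp contDiff_snd) (fun s x n => hper x n) t ht
    simp only [deriv_const, mul_zero, zero_add] at h
    simp only [r, u, hπ_of_mem t ht, hπ_of_mem 0 ⟨le_rfl, hT.le⟩]
    rw [← h]
    refine intervalIntegral.integral_congr fun s hs => ?_
    rw [Set.uIcc_of_le ht.1] at hs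
    simp only [hπ_of_mem s ⟨hs.1, hs.2.trans ht.2⟩]
  intro t ht
  have hkey : ∀ ε : ℝ, 0 < ε → ε ≤ 1 →
      |(∫ x in 𝒬, r (t, x) ^ 2) - ∫ x in 𝒬, r (0, x) ^ 2| ≤
        2 * C ^ 2 * ε ^ (2 * (bt : ℝ)) +
          2 * C ^ 2 * D * M * ε ^ (2 * (bt : ℝ) + β - 1) * t := by
    intro ε hε hε1
    obtain ⟨K, hK⟩ := hM ε hε hε1
    have hE := hK.abs_energy_sub_le_of_weakSol hr hu hweak
      (fun s _ => hK.abs_flux_le hε (hrt s) (hut s) (hdiv (π s)) (hρper (π s)) (hvper (π s))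
        C.coe_nonneg D.coe_nonneg bt.coe_nonneg β.coe_nonneg (hrH s) (huH s)) t ht
    have hen : ∀ s, _ := fun s => hK.abs_energy_sub_le hε (hrt s) (hρper (π s))
      C.coe_nonneg bt.coe_nonneg (hrH s)
    have ht' := abs_le.1 (hen t)
    have h0' := abs_le.1 (hen 0)
    have hE' := abs_le.1 hE
    refine le_of_mul_le_mul_left ?_ hK.mass_pos
    rw [← abs_of_pos hK.mass_pos, ← abs_mul, abs_of_pos hK.mass_pos]
    refine abs_le.2 ⟨?_, ?_⟩ <;> linarith
  have hlim : Filter.Tendsto (fun ε : ℝ => 2 * (C : ℝ) ^ 2 * ε ^ (2 * (bt : ℝ)) +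
      2 * C ^ 2 * D * M * ε ^ (2 * (bt : ℝ) + β - 1) * t) (nhdsWithin 0 (Set.Ioi 0)) (nhds 0) := by
    have hbt : 0 < 2 * (bt : ℝ) := by positivity
    have hex : 0 < 2 * (bt : ℝ) + β - 1 := by linarith
    have hc : Continuous fun ε : ℝ => 2 * (C : ℝ) ^ 2 * ε ^ (2 * (bt : ℝ)) +
        2 * C ^ 2 * D * M * ε ^ (2 * (bt : ℝ) + β - 1) * t :=
      (continuous_const.mul (Real.continuous_rpow_const hbt.le)).add
        ((continuous_const.mul (Real.continuous_rpow_const hex.le)).mul continuous_const)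
    have h := (hc.tendsto 0).mono_left (nhdsWithin_le_nhds (s := Set.Ioi 0))
    simpa only [Real.zero_rpow hbt.ne', Real.zero_rpow hex.ne', mul_zero, zero_mul, add_zero]
      using h
  have hle := ge_of_tendsto hlim (by
    filter_upwards [Ioc_mem_nhdsGT (zero_lt_one' ℝ)] with ε hε using hkey ε hε.1 hε.2)
  have heq := sub_eq_zero.1 (abs_nonpos_iff.1 hle)
  simpa only [r, hπ_of_mem t ht, hπ_of_mem 0 ⟨le_rfl, hT.le⟩] using heq
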